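/- arXiv:1601.06681 — 3 statements merged into one kernel-verified Lean document; each statement's English description precedes it below -/
import Mathlib

section
/- Let M ≥ 0 and let b : ℕ → ℕ → ℝ be a doubly indexed family of nonnegative real numbers such that b(0, j) ≤ M for all j, b(k+1, 0) ≤ b(k, 0) for all k, and b(k+1, j+1) ≤ b(k, j+1) + b(k, j) for all k, j. Then for all k and j, b(k, j) ≤ M · Σ_{i=0}^{j} binom(k, i), where binom(k, i) denotes the binomial coefficient k choose i. -/
open Finset

/-- Pascal's rule for partial row sums of binomial coefficients. -/
theorem sum_range_choose_succ_succ (k j : ℕ) :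
    ∑ i ∈ Finset.range (j + 2), (Nat.choose (k + 1) i : ℝ) =
      ∑ i ∈ Finset.range (j + 2), (Nat.choose k i : ℝ) +
        ∑ i ∈ Finset.range (j + 1), (Nat.choose k i : ℝ) := by
  rw [Finset.sum_range_succ', Finset.sum_range_succ' (fun i => (Nat.choose k i : ℝ)) (j + 1)]
  simp only [Nat.choose_succ_succ', Nat.cast_add, Finset.sum_add_distrib, Nat.choose_zero_right]
  ring

/-- Pascal-triangle-type superposition bound underlying the eHDG layer-sweep argument:
if `b 0 j ≤ M`, `b (k+1) 0 ≤ b k 0`, and `b (k+1) (j+1) ≤ b k (j+1) + b k j`, then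
`b k j ≤ M · Σ_{i=0}^{j} (k choose i)`. -/
theorem pascal_superposition_bound
    (M : ℝ) (hM : 0 ≤ M) (b : ℕ → ℕ → ℝ) (hb : ∀ k j, 0 ≤ b k j)
    (h0 : ∀ j, b 0 j ≤ M)
    (hrec0 : ∀ k, b (k + 1) 0 ≤ b k 0)
    (hrec : ∀ k j, b (k + 1) (j + 1) ≤ b k (j + 1) + b k j) :
    ∀ k j : ℕ, b k j ≤ M * ∑ i ∈ Finset.range (j + 1), (Nat.choose k i : ℝ) := by
  intro k
  induction k with
  | zero =>
    intro j
    simpa [Finset.sum_range_succ'] using h0 j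
  | succ k ih =>
    intro j
    cases j with
    | zero => simpa using (hrec0 k).trans (ih 0)
    | succ j =>
      rw [sum_range_choose_succ_succ, mul_add]
      exact (hrec k j).trans (add_le_add (ih (j + 1)) (ih j))
end

section
/- Let J ∈ ℕ, M ≥ 0, and let a : ℕ → {0,1,…,J} → ℝ be nonnegative numbers satisfying a(k+1, 0) ≤ (1/2)·a(k, 0) for all k, and a(k+1, j) ≤ (1/2)·(a(k, j) + a(k, j−1)) for all k and all 1 ≤ j ≤ J, with a(0, j) ≤ M for all j. Then for all k and all 0 ≤ j ≤ J, a(k, j) ≤ 2^{−k} · (Σ_{i=0}^{j} binom(k, i)) · M. In particular a(k, j) ≤ 2^{−k}·(k+1)^J·M, so a(k, j) → 0 as k → ∞, i.e. the iteration converges exponentially with a rate independent of j-independent data beyond M. -/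
open Finset

theorem sum_range_choose_succ (k j : ℕ) :
    ∑ i ∈ Finset.range (j + 2), (k + 1).choose i =
      ∑ i ∈ Finset.range (j + 2), k.choose i + ∑ i ∈ Finset.range (j + 1), k.choose i := by
  rw [Finset.sum_range_succ', Finset.sum_range_succ' (fun i => k.choose i) (j + 1)]
  simp only [Nat.choose_succ_succ', Finset.sum_add_distrib, Nat.choose_zero_right]
  ring

theorem sum_range_choose_le_succ_pow (k j : ℕ) :
    ∑ i ∈ Finset.range (j + 1), k.choose i ≤ (k + 1) ^ j := by
  induction j with
  | zero => simp
  | succ j ih =>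
    rw [Finset.sum_range_succ]
    calc ∑ i ∈ Finset.range (j + 1), k.choose i + k.choose (j + 1)
        ≤ (k + 1) ^ j + k ^ j * k := Nat.add_le_add ih (Nat.choose_le_pow k (j + 1))
      _ ≤ (k + 1) ^ j + (k + 1) ^ j * k := by gcongr; omega
      _ = (k + 1) ^ (j + 1) := by ring

/-- Abstract eHDG layer contraction for steady transport: with at most `J+1` layers,
`a (k+1) 0 ≤ (1/2) a k 0`, `a (k+1) j ≤ (1/2)(a k j + a k (j-1))` for `1 ≤ j ≤ J`, and
`a 0 j ≤ M`, one gets `a k j ≤ 2^{−k} (Σ_{i=0}^{j} (k choose i)) M ≤ 2^{−k} (k+1)^J M`,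
so the iteration converges exponentially in `k`. -/
theorem eHDG_transport_layer_decay
    (J : ℕ) (M : ℝ) (hM : 0 ≤ M) (a : ℕ → ℕ → ℝ)
    (ha : ∀ k j, j ≤ J → 0 ≤ a k j)
    (h0 : ∀ j, j ≤ J → a 0 j ≤ M)
    (hrec0 : ∀ k, a (k + 1) 0 ≤ (1 / 2) * a k 0)
    (hrec : ∀ k j, 1 ≤ j → j ≤ J → a (k + 1) j ≤ (1 / 2) * (a k j + a k (j - 1))) :
    ∀ k j : ℕ, j ≤ J →
      a k j ≤ (2 : ℝ) ^ (-(k : ℤ)) * (∑ i ∈ Finset.range (j + 1), (Nat.choose k i : ℝ)) * M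
      ∧ a k j ≤ (2 : ℝ) ^ (-(k : ℤ)) * ((k : ℝ) + 1) ^ J * M := by
  have layer_bound : ∀ k j : ℕ, j ≤ J → a k j ≤
      (2 : ℝ) ^ (-(k : ℤ)) * (∑ i ∈ Finset.range (j + 1), (Nat.choose k i : ℝ)) * M := by
    intro k
    induction k with
    | zero =>
      intro j hj
      simpa [Finset.sum_range_succ'] using h0 j hj
    | succ k ih =>
      have hpow : (2 : ℝ) ^ (-((k + 1 : ℕ) : ℤ)) = (1 / 2) * (2 : ℝ) ^ (-(k : ℤ)) := by
        rw [zpow_neg, zpow_neg, zpow_natCast, zpow_natCast, pow_succ, mul_inv]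
        ring
      intro j hj
      rw [hpow]
      cases j with
      | zero =>
        have h := ih 0 hj
        simp only [zero_add, Finset.sum_range_one, Nat.choose_zero_right, Nat.cast_one, mul_one] at h ⊢
        linarith [hrec0 k]
      | succ j =>
        have h := hrec k (j + 1) (by omega) hj
        rw [Nat.add_sub_cancel] at h
        have hsum : ∑ i ∈ Finset.range (j + 2), ((k + 1).choose i : ℝ) =
            ∑ i ∈ Finset.range (j + 2), (k.choose i : ℝ) +
              ∑ i ∈ Finset.range (j + 1), (k.choose i : ℝ) := by
          exact_mod_cast sum_range_choose_succ k j
        rw [hsum]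
        linarith [ih (j + 1) hj, ih j (by omega)]
  intro k j hj
  refine ⟨layer_bound k j hj, (layer_bound k j hj).trans ?_⟩
  have hsum : ∑ i ∈ Finset.range (j + 1), (k.choose i : ℝ) ≤ ((k : ℝ) + 1) ^ J := by
    exact_mod_cast (sum_range_choose_le_succ_pow k j).trans
      (Nat.pow_le_pow_right (Nat.succ_pos k) hj)
  gcongr
end

section
/- Let p ∈ ℕ and let u be a real polynomial of degree at most p. Then u(1)² ≤ ((p+1)²/2) · ∫_{−1}^{1} u(x)² dx. Consequently, by symmetry, also u(−1)² ≤ ((p+1)²/2) · ∫_{−1}^{1} u(x)² dx, so the squared boundary values of a degree-p polynomial on an interval are controlled by (p+1)²/|interval| times its squared L² norm. -/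
open Polynomial intervalIntegral

namespace InverseTrace

lemma intervalIntegrable_eval (f : ℝ[X]) (a b : ℝ) :
    IntervalIntegrable (fun x => f.eval x) MeasureTheory.volume a b :=
  f.continuous.intervalIntegrable a b

/-- Integration of polynomials over `[-1, 1]`, as a linear functional. -/
noncomputable def integral : ℝ[X] →ₗ[ℝ] ℝ where
  toFun f := ∫ x in (-1 : ℝ)..1, f.eval x
  map_add' f g := by
    simp only [eval_add]
    exact integral_add (intervalIntegrable_eval f _ _) (intervalIntegrable_eval g _ _)
  map_smul' c f := by simp

lemma integral_apply (f : ℝ[X]) : integral f = ∫ x in (-1 : ℝ)..1, f.eval x := rfl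

lemma integral_derivative (f : ℝ[X]) : integral (derivative f) = f.eval 1 - f.eval (-1) :=
  integral_eq_sub_of_hasDerivAt (fun x _ => f.hasDerivAt x) (intervalIntegrable_eval _ _ _)

lemma integral_C_mul (c : ℝ) (f : ℝ[X]) : integral (C c * f) = c * integral f := by
  rw [← smul_eq_C_mul, map_smul, smul_eq_mul]

lemma integral_sq_nonneg (f : ℝ[X]) : 0 ≤ integral (f ^ 2) := by
  rw [integral_apply]
  exact integral_nonneg (by norm_num) fun x _ => by rw [eval_pow]; positivity

/-- Integration by parts for polynomials. -/
lemma integral_derivative_mul (f g : ℝ[X]) :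
    integral (derivative f * g) =
      f.eval 1 * g.eval 1 - f.eval (-1) * g.eval (-1) - integral (f * derivative g) := by
  have h := integral_derivative (f * g)
  rw [derivative_mul, map_add, eval_mul, eval_mul] at h
  linarith

/-- The polynomial `(X - 1) ^ (p + 1) * (X + 1) ^ p`. -/
noncomputable def weight (p : ℕ) : ℝ[X] := (X - C 1) ^ (p + 1) * (X - C (-1)) ^ p

lemma eval_one_iterate_derivative_weight {p k : ℕ} (hk : k ≤ p) :
    (derivative^[k] (weight p)).eval 1 = 0 := by
  have h := pow_sub_dvd_iterate_derivative_of_pow_dvd k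
    (Dvd.intro _ rfl : (X - C (1 : ℝ)) ^ (p + 1) ∣ weight p)
  exact dvd_iff_isRoot.1 ((dvd_pow_self _ (by omega)).trans h)

lemma eval_neg_one_iterate_derivative_weight {p k : ℕ} (hk : k < p) :
    (derivative^[k] (weight p)).eval (-1) = 0 := by
  have h := pow_sub_dvd_iterate_derivative_of_pow_dvd k
    (Dvd.intro_left _ rfl : (X - C (-1 : ℝ)) ^ p ∣ weight p)
  exact dvd_iff_isRoot.1 ((dvd_pow_self _ (by omega)).trans h)

lemma integral_iterate_derivative_weight_mul {p k : ℕ} (hk : k ≤ p) (v : ℝ[X])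
    (hv : v.degree < k) : integral (derivative^[k] (weight p) * v) = 0 := by
  induction k generalizing v with
  | zero =>
    have : v = 0 := by simpa using hv
    simp [this]
  | succ k ih =>
    rw [Function.iterate_succ_apply', integral_derivative_mul,
      eval_one_iterate_derivative_weight (by omega),
      eval_neg_one_iterate_derivative_weight (by omega), ih (by omega)]
    · simp
    · by_cases h0 : v = 0
      · simp [h0]
      · refine (degree_derivative_lt h0).trans_le ?_
        rw [← natDegree_lt_iff_degree_lt h0] at hv
        exact natDegree_le_iff_degree_le.1 (by omega)

/-- The quotient of the `k`-th derivative of `weight p` by `(X - 1) ^ (p + 1 - k)`. For `k = p`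
this is, up to a scalar, the representer of evaluation at `1` on polynomials of degree at most
`p`. -/
noncomputable def quotient (p : ℕ) : ℕ → ℝ[X]
  | 0 => (X - C (-1)) ^ p
  | k + 1 => C ((p : ℝ) + 1 - k) * quotient p k + (X - C 1) * derivative (quotient p k)

lemma iterate_derivative_weight {p k : ℕ} (hk : k ≤ p) :
    derivative^[k] (weight p) = (X - C 1) ^ (p - k + 1) * quotient p k := by
  induction k with
  | zero => simp [weight, quotient]
  | succ k ih =>
    obtain ⟨m, rfl⟩ := Nat.exists_eq_add_of_le hk
    rw [Function.iterate_succ_apply', ih (by omega)]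
    have h₁ : k + 1 + m - k + 1 = m + 2 := by omega
    have h₂ : k + 1 + m - (k + 1) + 1 = m + 1 := by omega
    have h₃ : ((k + 1 + m : ℕ) : ℝ) + 1 - k = ((m + 2 : ℕ) : ℝ) := by push_cast; ring
    rw [h₁, h₂, quotient, h₃, derivative_mul, derivative_X_sub_C_pow]
    simp only [Nat.add_succ_sub_one, map_natCast]
    ring

lemma natDegree_quotient_le (p k : ℕ) : (quotient p k).natDegree ≤ p := by
  induction k with
  | zero => rw [quotient, natDegree_pow, natDegree_X_sub_C, mul_one]
  | succ k ih =>
    refine natDegree_add_le_of_degree_le ((natDegree_C_mul_le _ _).trans ih) ?_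
    by_cases h : (quotient p k).natDegree = 0
    · rw [derivative_of_natDegree_zero h]; simp
    · refine natDegree_mul_le.trans ?_
      have := natDegree_derivative_lt h
      rw [natDegree_X_sub_C]
      omega

lemma eval_neg_one_quotient {p k : ℕ} (hk : k < p) : (quotient p k).eval (-1) = 0 := by
  have h := eval_neg_one_iterate_derivative_weight hk
  rw [iterate_derivative_weight hk.le, eval_mul] at h
  refine (mul_eq_zero.1 h).resolve_left ?_
  rw [eval_pow]
  exact pow_ne_zero _ (by norm_num)

lemma eval_one_quotient {p k : ℕ} (hk : k ≤ p) :
    (p - k + 1).factorial * (quotient p k).eval 1 = (p + 1).factorial * 2 ^ p := by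
  induction k with
  | zero => norm_num [quotient]
  | succ k ih =>
    rw [← ih (by omega)]
    obtain ⟨m, rfl⟩ := Nat.exists_eq_add_of_le hk
    have h₁ : k + 1 + m - k + 1 = m + 1 + 1 := by omega
    have h₂ : k + 1 + m - (k + 1) + 1 = m + 1 := by omega
    rw [h₁, h₂, Nat.factorial_succ (m + 1), quotient]
    simp only [eval_add, eval_mul, eval_sub, eval_X, eval_C, sub_self, zero_mul, add_zero]
    push_cast
    ring

lemma integral_quotient {p k : ℕ} (hk : k ≤ p) :
    (p - k).factorial * integral (quotient p k) =
      p.factorial * (2 ^ (p + 1) / ((p : ℝ) + 1)) := by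
  induction k with
  | zero =>
    have h := integral_derivative ((X - C (-1)) ^ (p + 1))
    rw [derivative_X_sub_C_pow, integral_C_mul] at h
    norm_num at h
    have hp : (p : ℝ) + 1 ≠ 0 := by positivity
    rw [quotient, Nat.sub_zero, ← h]
    norm_num
    field_simp
    simp
  | succ k ih =>
    rw [← ih (by omega)]
    have h0 := eval_neg_one_quotient (Nat.lt_of_succ_le hk)
    have h := integral_derivative_mul (quotient p k) (X - C 1)
    obtain ⟨m, rfl⟩ := Nat.exists_eq_add_of_le hk
    have h₁ : k + 1 + m - k = m + 1 := by omega
    have h₂ : k + 1 + m - (k + 1) = m := by omega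
    rw [h0, derivative_X_sub_C, mul_one] at h
    simp only [eval_sub, eval_X, eval_C, sub_self, mul_zero, zero_mul, zero_sub] at h
    rw [h₁, h₂, Nat.factorial_succ, quotient, map_add, integral_C_mul,
      mul_comm (X - C 1), h]
    push_cast
    ring

lemma integral_quotient_mul {p : ℕ} (u : ℝ[X]) (hu : u.natDegree ≤ p) :
    integral (quotient p p * u) = u.eval 1 * integral (quotient p p) := by
  obtain ⟨v, hv⟩ : X - C 1 ∣ u - C (u.eval 1) := X_sub_C_dvd_sub_C_eval
  have hdeg : v.degree < p := by
    by_cases h0 : v = 0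
    · simp [h0]
    rw [← natDegree_lt_iff_degree_lt h0]
    have h := congrArg natDegree hv
    rw [natDegree_sub_C, natDegree_mul (X_sub_C_ne_zero _) h0, natDegree_X_sub_C] at h
    omega
  have h := integral_iterate_derivative_weight_mul le_rfl v hdeg
  rw [iterate_derivative_weight le_rfl, Nat.sub_self, zero_add, pow_one] at h
  have hsplit : quotient p p * u =
      C (u.eval 1) * quotient p p + (X - C 1) * quotient p p * v := by
    linear_combination quotient p p * hv
  rw [hsplit, map_add, h, integral_C_mul, add_zero]

/-- The inverse trace inequality at the right end point. -/
lemma eval_one_sq_le {p : ℕ} (u : ℝ[X]) (hu : u.natDegree ≤ p) :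
    u.eval 1 ^ 2 ≤ ((p : ℝ) + 1) ^ 2 / 2 * integral (u ^ 2) := by
  have hI := integral_quotient (le_refl p)
  have hQ := eval_one_quotient (le_refl p)
  have hQQ := integral_quotient_mul _ (natDegree_quotient_le p p)
  have hQu := integral_quotient_mul u hu
  simp only [Nat.sub_self, zero_add, Nat.factorial_zero, Nat.factorial_one, Nat.cast_one,
    one_mul] at hI hQ
  have hp : (0 : ℝ) < p + 1 := by positivity
  have hfac : (0 : ℝ) < p.factorial := by positivity
  have hpos : 0 < (quotient p p).eval 1 := by rw [hQ]; positivity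
  have hratio : (quotient p p).eval 1 = ((p : ℝ) + 1) ^ 2 / 2 * integral (quotient p p) := by
    rw [hQ, hI, Nat.factorial_succ]
    push_cast
    field_simp
    ring
  set q := quotient p p
  have hsq := integral_sq_nonneg (C (q.eval 1) * u - C (u.eval 1) * q)
  have hexp : (C (q.eval 1) * u - C (u.eval 1) * q) ^ 2 =
      C (q.eval 1 ^ 2) * u ^ 2 - C (2 * q.eval 1 * u.eval 1) * (q * u)
        + C (u.eval 1 ^ 2) * (q * q) := by
    simp only [map_mul, map_pow, map_ofNat]
    ring
  rw [hexp, map_add, map_sub, integral_C_mul, integral_C_mul, integral_C_mul, hQu, hQQ] at hsq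
  have hmul : 0 ≤ q.eval 1 * (q.eval 1 * integral (u ^ 2) - u.eval 1 ^ 2 * integral q) := by
    linarith
  have hle := nonneg_of_mul_nonneg_right hmul hpos
  have hI_pos : 0 < integral q := by rw [hI]; positivity
  rw [hratio] at hle
  refine le_of_mul_le_mul_right ?_ hI_pos
  linarith

end InverseTrace

/-- One-dimensional polynomial inverse trace inequality: for a real polynomial `u` of
degree at most `p`,
`u(1)² ≤ ((p+1)²/2) ∫_{−1}^{1} u(x)² dx` and `u(−1)² ≤ ((p+1)²/2) ∫_{−1}^{1} u(x)² dx`. -/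
theorem polynomial_inverse_trace_inequality (p : ℕ) (u : Polynomial ℝ)
    (hdeg : u.natDegree ≤ p) :
    (u.eval 1) ^ 2 ≤ (((p : ℝ) + 1) ^ 2 / 2) * ∫ x in (-1 : ℝ)..1, (u.eval x) ^ 2
    ∧ (u.eval (-1)) ^ 2 ≤ (((p : ℝ) + 1) ^ 2 / 2) * ∫ x in (-1 : ℝ)..1, (u.eval x) ^ 2 := by
  constructor
  · simpa [InverseTrace.integral_apply] using InverseTrace.eval_one_sq_le u hdeg
  · have h := InverseTrace.eval_one_sq_le (p := p) (u.comp (-X)) (by simpa [natDegree_comp])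
    simp only [InverseTrace.integral_apply, eval_pow, eval_comp, eval_neg, eval_X] at h
    rwa [integral_comp_neg (fun x => u.eval x ^ 2), neg_neg] at h
end
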